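/- There is no 3-stage commutator-free Runge–Kutta method of order 3 whose underlying coefficients satisfy a_32 = 1/(2 a_21) and a_31 = (2 a_21 − 1)/(2 a_21). Precisely: there exist no real numbers a_21 ≠ 0 and β_1 = (β_1^1, β_1^2, β_1^3), β_2 = (β_2^1, β_2^2, β_2^3) such that, with c_2 = a_21, a_32 = 1/(2 a_21), a_31 = (2 a_21 − 1)/(2 a_21), c_3 = a_31 + a_32 = 1, and b_k = β_1^k + β_2^k, the classical order-3 conditions ∑ b_k = 1, b_2 c_2 + b_3 c_3 = 1/2, b_2 c_2² + b_3 c_3² = 1/3, b_3 a_32 c_2 = 1/6 hold together with the non-classical condition β_1^2 c_2 + β_1^3 c_3 + (1/2)(β_2^1 + β_2^2 + β_2^3) = 1/3. -/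

import Mathlib

/-- There is no 3-stage commutator-free Runge–Kutta method of order 3 whose
underlying coefficients satisfy `a32 = 1/(2 a21)` and `a31 = (2 a21 - 1)/(2 a21)`.
Here `c2 = a21`, `c3 = a31 + a32`, `b k = β1 k + β2 k`, and the conditions are the
classical order-3 conditions together with the non-classical condition
`β1^2 c2 + β1^3 c3 + (1/2) (β2^1 + β2^2 + β2^3) = 1/3`. -/
theorem no_cf3_reusing_without_extra_exponential :
    ¬ ∃ (a21 β11 β12 β13 β21 β22 β23 : ℝ),
      a21 ≠ 0 ∧
      (let c2 : ℝ := a21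
       let a32 : ℝ := 1 / (2 * a21)
       let a31 : ℝ := (2 * a21 - 1) / (2 * a21)
       let c3 : ℝ := a31 + a32
       let b1 : ℝ := β11 + β21
       let b2 : ℝ := β12 + β22
       let b3 : ℝ := β13 + β23
       b1 + b2 + b3 = 1 ∧
       b2 * c2 + b3 * c3 = 1 / 2 ∧
       b2 * c2 ^ 2 + b3 * c3 ^ 2 = 1 / 3 ∧
       b3 * a32 * c2 = 1 / 6 ∧
       β12 * c2 + β13 * c3 + (1 / 2) * (β21 + β22 + β23) = 1 / 3) := by
  rintro ⟨a, β11, β12, β13, β21, β22, β23, ha, h⟩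
  obtain ⟨-, h2, h3, h4, -⟩ := h
  have hc : (2 * a - 1) / (2 * a) + 1 / (2 * a) = 1 := by
    field_simp
    ring
  have hp : 1 / (2 * a) * a = 1 / 2 := by
    field_simp
  rw [hc] at h2 h3
  rw [mul_assoc, hp] at h4
  -- `b3 = 1/3`, so `b2 * a = 1/6` while `b2 * a ^ 2 = 0`
  have h5 : (β12 + β22) * a = 1 / 6 := by linarith
  have h6 : (β12 + β22) * a * a = 0 := by linarith
  rw [h5] at h6
  exact ha (by linarith)
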